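/- arXiv:1808.01889 — 3 statements merged into one kernel-verified Lean document; each statement's English description precedes it below -/
import Mathlib

section
/- Let S be a Stäckel matrix on ℝ^N with entries S(q)_{r,j} = σ_{r,j}(q_r), σ_{r,j} differentiable, let v_r : ℝ → ℝ be differentiable, and set α^r(q) = (S^{-1}(q))_{1,r}, H_r(q,p) = ½(p_r² + v_r(q_r)), H = Σ_r α^r H_r. Let (q(t), p(t)), t ∈ I (I a real interval), be a differentiable curve satisfying Hamilton's equations for H, and suppose c ∈ ℝ^N is such that Σ_r (S^{-1}(q(t)))_{j,r} H_r(q(t),p(t)) = c_j for all t ∈ I and all j. Then for every index r and every t ∈ I: dq_r/dt = α^r(q(t)) · p_r(t) and dp_r/dt = α^r(q(t)) · ( Σ_j c_j σ_{r,j}'(q_r(t)) − ½ v_r'(q_r(t)) ). Hence the r-th component of the Hamiltonian vector field of H along the orbit equals α^r(q(t)) times the Hamiltonian vector field of the one-dimensional Hamiltonian H̃_r(x,y) = ½(y² + v_r(x)) − Σ_j c_j σ_{r,j}(x) evaluated at (q_r(t), p_r(t)). -/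
open scoped BigOperators

theorem differentiable_matrix_det {E : Type*} [NormedAddCommGroup E] [NormedSpace ℝ E]
    {n : Type*} [Fintype n] [DecidableEq n] {A : E → Matrix n n ℝ}
    (hA : ∀ i j, Differentiable ℝ fun x => A x i j) :
    Differentiable ℝ fun x => (A x).det := by
  simp only [Matrix.det_apply]
  fun_prop

theorem differentiable_matrix_inv_apply {E : Type*} [NormedAddCommGroup E] [NormedSpace ℝ E]
    {n : Type*} [Fintype n] [DecidableEq n] {A : E → Matrix n n ℝ}
    (hA : ∀ i j, Differentiable ℝ fun x => A x i j) (hdet : ∀ x, IsUnit (A x).det) (i j : n) :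
    Differentiable ℝ fun x => (A x)⁻¹ i j := by
  have hadj : Differentiable ℝ fun x => (A x).adjugate i j := by
    simp only [Matrix.adjugate_apply]
    refine differentiable_matrix_det fun k l => ?_
    by_cases hk : k = j
    · subst hk
      simp
    · simpa [Matrix.updateRow_ne hk] using hA k l
  simp only [Matrix.inv_def, Ring.inverse_eq_inv', Matrix.smul_apply, smul_eq_mul]
  exact ((differentiable_matrix_det hA).inv fun x => (hdet x).ne_zero).mul hadj

/-- A first integral of a Stäckel system is a constant plus a combination of the
one-dimensional Hamiltonians obtained by fixing the values of the first integrals. -/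
theorem sum_inv_mul_eq_add_sum {n : Type*} [Fintype n] [DecidableEq n] {A : Matrix n n ℝ}
    (hA : IsUnit A.det) (c h : n → ℝ) (i : n) :
    ∑ r, A⁻¹ i r * h r = c i + ∑ r, A⁻¹ i r * (h r - ∑ j, c j * A r j) := by
  have hc : ∑ r, A⁻¹ i r * ∑ j, c j * A r j = c i := by
    have := congrFun (show A⁻¹.mulVec (A.mulVec c) = c by
      rw [Matrix.mulVec_mulVec, Matrix.nonsing_inv_mul A hA, Matrix.one_mulVec]) i
    simpa only [Matrix.mulVec, dotProduct, mul_comm (c _)] using this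
  simp only [mul_sub, Finset.sum_sub_distrib, hc]
  ring

theorem eq_sum_mul_of_sum_inv_mul_eq {n : Type*} [Fintype n] [DecidableEq n] {A : Matrix n n ℝ}
    (hA : IsUnit A.det) {c h : n → ℝ} (hc : ∀ j, ∑ r, A⁻¹ j r * h r = c j) (r : n) :
    h r = ∑ j, c j * A r j := by
  have hc' : A⁻¹.mulVec h = c := funext hc
  have := congrFun (show A.mulVec c = h by
    rw [← hc', Matrix.mulVec_mulVec, Matrix.mul_nonsing_inv A hA, Matrix.one_mulVec]) r
  simpa only [Matrix.mulVec, dotProduct, mul_comm (c _)] using this.symm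

theorem hasDerivAt_mul_of_eq_zero {a d : ℝ → ℝ} {d' x : ℝ} (ha : DifferentiableAt ℝ a x)
    (hd : HasDerivAt d d' x) (h0 : d x = 0) : HasDerivAt (fun y => a y * d y) (a x * d') x := by
  exact (ha.hasDerivAt.fun_mul hd).congr_deriv (by simp [h0])

/-- Along an orbit of the Stäckel Hamiltonian
`H = ∑ r α^r H_r` (with `α^r = (S⁻¹)_{1,r}`, `H_r = ½(p_r² + v_r(q_r))`) on
which the separated first integrals have constant values `c_j`, the `r`-th
pair of Hamilton's equations reads `dq_r/dt = α^r(q) p_r` and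
`dp_r/dt = α^r(q)(∑_j c_j σ'_{r,j}(q_r) − ½ v'_r(q_r))`; i.e., the `r`-th
component of `X_H` equals `α^r` times the Hamiltonian vector field of the
one-dimensional Hamiltonian `H̃_r(x,y) = ½(y² + v_r(x)) − ∑_j c_j σ_{r,j}(x)`
at `(q_r, p_r)`. -/
theorem stmt_5 (N : ℕ) [NeZero N]
    (S : (Fin N → ℝ) → Matrix (Fin N) (Fin N) ℝ)
    (σ : Fin N → Fin N → ℝ → ℝ)
    (hσ : ∀ r j, Differentiable ℝ (σ r j))
    (hS : ∀ q r j, S q r j = σ r j (q r))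
    (hinv : ∀ q, IsUnit (S q).det)
    (v : Fin N → ℝ → ℝ) (hv : ∀ r, Differentiable ℝ (v r))
    (H : (Fin N → ℝ) × (Fin N → ℝ) → ℝ)
    (hH : ∀ x, H x = ∑ r : Fin N, (S x.1)⁻¹ 0 r * ((1 / 2) * ((x.2 r) ^ 2 + v r (x.1 r))))
    (I : Set ℝ) (hI : I.OrdConnected)
    (q p : ℝ → Fin N → ℝ)
    (hq : ∀ t ∈ I, ∀ i, DifferentiableAt ℝ (fun s => q s i) t)
    (hp : ∀ t ∈ I, ∀ i, DifferentiableAt ℝ (fun s => p s i) t)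
    (hHam : ∀ t ∈ I, ∀ i : Fin N,
      deriv (fun s => q s i) t = fderiv ℝ H (q t, p t) (0, Pi.single i 1) ∧
      deriv (fun s => p s i) t = -fderiv ℝ H (q t, p t) (Pi.single i 1, 0))
    (c : Fin N → ℝ)
    (hc : ∀ t ∈ I, ∀ j : Fin N,
      ∑ r : Fin N, (S (q t))⁻¹ j r * ((1 / 2) * ((p t r) ^ 2 + v r (q t r))) = c j) :
    ∀ (r : Fin N), ∀ t ∈ I,
      deriv (fun s => q s r) t = (S (q t))⁻¹ 0 r * p t r ∧
      deriv (fun s => p s r) t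
        = (S (q t))⁻¹ 0 r *
            ((∑ j : Fin N, c j * deriv (σ r j) (q t r)) - (1 / 2) * deriv (v r) (q t r)) ∧
      deriv (fun s => q s r) t
        = (S (q t))⁻¹ 0 r *
            deriv (fun y : ℝ => (1 / 2) * (y ^ 2 + v r (q t r))
              - ∑ j : Fin N, c j * σ r j (q t r)) (p t r) ∧
      deriv (fun s => p s r) t
        = -((S (q t))⁻¹ 0 r) *
            deriv (fun x : ℝ => (1 / 2) * ((p t r) ^ 2 + v r x)
              - ∑ j : Fin N, c j * σ r j x) (q t r) := by
  have hSd : ∀ i j, Differentiable ℝ fun x => S x i j := by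
    intro i j
    simp only [hS]
    exact (hσ i j).comp (differentiable_apply i)
  have hα := differentiable_matrix_inv_apply hSd hinv 0
  have hHd : Differentiable ℝ H := by
    rw [funext hH]
    refine Differentiable.fun_sum fun r _ => ((hα r).comp differentiable_fst).mul ?_
    have h1 : Differentiable ℝ fun x : (Fin N → ℝ) × (Fin N → ℝ) => v r (x.1 r) :=
      (hv r).comp (by fun_prop)
    fun_prop
  intro r t ht
  let d : Fin N → ℝ → ℝ → ℝ := fun k x y =>
    (1 / 2) * (y ^ 2 + v k x) - ∑ j, c j * σ k j x
  have hHeq : ∀ x, H x = c 0 + ∑ k, (S x.1)⁻¹ 0 k * d k (x.1 k) (x.2 k) := by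
    intro x
    rw [hH, sum_inv_mul_eq_add_sum (hinv x.1) c]
    simp only [hS, d]
  have hd0 : ∀ k, d k (q t k) (p t k) = 0 := by
    intro k
    have := eq_sum_mul_of_sum_inv_mul_eq (hinv (q t)) (hc t ht) k
    simp only [hS] at this
    exact sub_eq_zero.2 this
  have hdy : HasDerivAt (fun y => d r (q t r) y) (p t r) (p t r) := by
    have := ((((hasDerivAt_id (p t r)).pow 2).add_const (v r (q t r))).const_mul
      (1 / 2 : ℝ)).sub_const (∑ j, c j * σ r j (q t r))
    refine this.congr_deriv ?_
    simp
  have hdx : HasDerivAt (fun x => d r x (p t r))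
      (1 / 2 * deriv (v r) (q t r) - ∑ j, c j * deriv (σ r j) (q t r)) (q t r) :=
    (((hv r _).hasDerivAt.const_add _).const_mul _).sub
      (HasDerivAt.fun_sum fun j _ => (hσ r j _).hasDerivAt.const_mul _)
  have hHp : fderiv ℝ H (q t, p t) (0, Pi.single r 1) = (S (q t))⁻¹ 0 r * p t r := by
    have hline : HasDerivAt (fun y => (q t, Function.update (p t) r y))
        ((0 : Fin N → ℝ), Pi.single r (1 : ℝ)) (p t r) :=
      (hasDerivAt_const _ _).prodMk (hasDerivAt_update _ _ _)
    have h1 := (hHd _).hasFDerivAt.comp_hasDerivAt (p t r) hline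
    rw [Function.update_eq_self] at h1
    refine h1.unique ?_
    have h2 := (hasDerivAt_mul_of_eq_zero
      (differentiableAt_const ((S (q t))⁻¹ 0 r)) hdy (hd0 r)).const_add (c 0)
    convert h2 using 1
    funext y
    simp only [Function.comp, hHeq]
    rw [Finset.sum_eq_single r _ (by simp)]
    · simp
    · intro k _ hk
      simp [Function.update_of_ne hk, hd0]
  have hHq : fderiv ℝ H (q t, p t) (Pi.single r 1, 0) = (S (q t))⁻¹ 0 r *
      (1 / 2 * deriv (v r) (q t r) - ∑ j, c j * deriv (σ r j) (q t r)) := by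
    have hupd := hasDerivAt_update (𝕜 := ℝ) (q t) r (q t r)
    have hline : HasDerivAt (fun x => (Function.update (q t) r x, p t))
        (Pi.single r (1 : ℝ), (0 : Fin N → ℝ)) (q t r) :=
      hupd.prodMk (hasDerivAt_const _ _)
    have h1 := (hHd _).hasFDerivAt.comp_hasDerivAt (q t r) hline
    rw [Function.update_eq_self] at h1
    refine h1.unique ?_
    have h2 := (hasDerivAt_mul_of_eq_zero
      ((hα r _).comp (q t r) hupd.differentiableAt) hdx (hd0 r)).const_add (c 0)
    simp only [Function.comp, Function.update_eq_self] at h2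
    convert h2 using 1
    funext x
    simp only [Function.comp, hHeq]
    rw [Finset.sum_eq_single r _ (by simp)]
    · simp
    · intro k _ hk
      simp [Function.update_of_ne hk, hd0]
  obtain ⟨hqt, hpt⟩ := hHam t ht r
  rw [hHp] at hqt
  rw [hHq] at hpt
  refine ⟨hqt, ?_, ?_, ?_⟩
  · rw [hpt]
    ring
  · rw [hqt, hdy.deriv]
  · rw [hpt, hdx.deriv]
    ring
end

section
/- Let S be a Stäckel matrix on ℝ^N with entries S(q)_{r,j} = σ_{r,j}(q_r), σ_{r,j} differentiable, let v_r : ℝ → ℝ be differentiable, and set H_r(q,p) = ½(p_r² + v_r(q_r)) and H(q,p) = Σ_r (S^{-1}(q))_{1,r} H_r(q,p). Let (q(t), p(t)), t ∈ I (I a real interval), be a differentiable curve satisfying Hamilton's equations for H. Then for every j ∈ Fin N, the function t ↦ K_j(t) := Σ_r (S^{-1}(q(t)))_{j,r} H_r(q(t), p(t)) is constant on I; in particular H itself is constant along the curve. -/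
open scoped BigOperators

/-- The Stäckel integral `K_j(q, p) = ∑ r (S⁻¹(q))_{j,r} H_r(q, p)`, where
`H_r(q, p) = ½(p_r² + v_r(q_r))`. -/
noncomputable def stackelIntegral {N : ℕ} (S : (Fin N → ℝ) → Matrix (Fin N) (Fin N) ℝ)
    (v : Fin N → ℝ → ℝ) (j : Fin N) (x : (Fin N → ℝ) × (Fin N → ℝ)) : ℝ :=
  ∑ r : Fin N, (S x.1)⁻¹ j r * ((1 / 2) * ((x.2 r) ^ 2 + v r (x.1 r)))

theorem Differentiable.matrix_det {E n : Type*} [NormedAddCommGroup E] [NormedSpace ℝ E]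
    [Fintype n] [DecidableEq n] {A : E → Matrix n n ℝ}
    (hA : ∀ i j, Differentiable ℝ fun x => A x i j) :
    Differentiable ℝ fun x => (A x).det := by
  simp only [Matrix.det_apply']
  fun_prop

theorem Differentiable.matrix_inv_apply {E n : Type*} [NormedAddCommGroup E] [NormedSpace ℝ E]
    [Fintype n] [DecidableEq n] {A : E → Matrix n n ℝ}
    (hA : ∀ i j, Differentiable ℝ fun x => A x i j) (hdet : ∀ x, IsUnit (A x).det) (i j : n) :
    Differentiable ℝ fun x => (A x)⁻¹ i j := by
  have hadj : Differentiable ℝ fun x => (A x).adjugate i j := by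
    simp only [Matrix.adjugate_apply]
    refine Differentiable.matrix_det fun k l => ?_
    simp only [Matrix.updateRow_apply]
    split_ifs
    · exact differentiable_const _
    · exact hA k l
  simp only [Matrix.inv_def, Ring.inverse_eq_inv', Matrix.smul_apply, smul_eq_mul]
  exact ((Differentiable.matrix_det hA).inv fun x => (hdet x).ne_zero).mul hadj

section Stackel

variable {N : ℕ} {S : (Fin N → ℝ) → Matrix (Fin N) (Fin N) ℝ} {σ : Fin N → Fin N → ℝ → ℝ}
  {v : Fin N → ℝ → ℝ}

theorem differentiable_stackelIntegral (hσ : ∀ r j, Differentiable ℝ (σ r j))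
    (hS : ∀ q r j, S q r j = σ r j (q r)) (hinv : ∀ q, IsUnit (S q).det)
    (hv : ∀ r, Differentiable ℝ (v r)) (j : Fin N) :
    Differentiable ℝ (stackelIntegral S v j) := by
  have hSinv (r : Fin N) :
      Differentiable ℝ fun x : (Fin N → ℝ) × (Fin N → ℝ) => (S x.1)⁻¹ j r := by
    refine Differentiable.matrix_inv_apply
      (A := fun x : (Fin N → ℝ) × (Fin N → ℝ) => S x.1) (fun i k => ?_) (fun x => hinv x.1) j r
    simp only [hS]
    exact (hσ i k).comp (by fun_prop)
  have hvq (r : Fin N) : Differentiable ℝ fun x : (Fin N → ℝ) × (Fin N → ℝ) => v r (x.1 r) :=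
    (hv r).comp (by fun_prop)
  have hp (r : Fin N) : Differentiable ℝ fun x : (Fin N → ℝ) × (Fin N → ℝ) => x.2 r := by
    fun_prop
  exact Differentiable.fun_sum fun r _ =>
    (hSinv r).mul ((((hp r).pow 2).add (hvq r)).const_mul (1 / 2))

theorem sum_mul_stackelIntegral (hS : ∀ q r j, S q r j = σ r j (q r))
    (hinv : ∀ q, IsUnit (S q).det) (x : (Fin N → ℝ) × (Fin N → ℝ)) (r : Fin N) :
    ∑ j, σ r j (x.1 r) * stackelIntegral S v j x = (1 / 2) * ((x.2 r) ^ 2 + v r (x.1 r)) := by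
  let h : Fin N → ℝ := fun r => (1 / 2) * ((x.2 r) ^ 2 + v r (x.1 r))
  have key : (S x.1).mulVec ((S x.1)⁻¹.mulVec h) = h := by
    rw [Matrix.mulVec_mulVec, Matrix.mul_nonsing_inv _ (hinv x.1), Matrix.one_mulVec]
  simpa only [Matrix.mulVec, dotProduct, hS, stackelIntegral, h] using congrFun key r

/-- All partial derivatives of the Stäckel integrals are proportional to the columns of `S⁻¹`,
with coefficients that do not depend on the integral. -/
theorem fderiv_stackelIntegral_apply (hσ : ∀ r j, Differentiable ℝ (σ r j))
    (hS : ∀ q r j, S q r j = σ r j (q r)) (hinv : ∀ q, IsUnit (S q).det)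
    (hv : ∀ r, Differentiable ℝ (v r)) (j : Fin N) (x d : (Fin N → ℝ) × (Fin N → ℝ)) :
    fderiv ℝ (stackelIntegral S v j) x d = ∑ r, (S x.1)⁻¹ j r *
      (((1 / 2) * deriv (v r) (x.1 r) - ∑ k, deriv (σ r k) (x.1 r) * stackelIntegral S v k x)
        * d.1 r + x.2 r * d.2 r) := by
  have key : (S x.1).mulVec (fun k => fderiv ℝ (stackelIntegral S v k) x d) = fun r =>
      ((1 / 2) * deriv (v r) (x.1 r) - ∑ k, deriv (σ r k) (x.1 r) * stackelIntegral S v k x)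
        * d.1 r + x.2 r * d.2 r := by
    funext r
    have hq := (hasFDerivAt_apply (𝕜 := ℝ) r x.1).comp x
      (hasFDerivAt_fst (𝕜 := ℝ) (p := x))
    have hp := (hasFDerivAt_apply (𝕜 := ℝ) r x.2).comp x
      (hasFDerivAt_snd (𝕜 := ℝ) (p := x))
    have hl := HasFDerivAt.fun_sum (u := Finset.univ) fun k _ =>
      ((hσ r k (x.1 r)).hasDerivAt.comp_hasFDerivAt x hq).mul
        (differentiable_stackelIntegral hσ hS hinv hv k x).hasFDerivAt
    have hr := ((hp.pow 2).add ((hv r (x.1 r)).hasDerivAt.comp_hasFDerivAt x hq)).const_mul (1 / 2)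
    have heq := congrArg (fun L => L d) (hl.unique (hr.congr_of_eventuallyEq
      (.of_forall fun y => sum_mul_stackelIntegral hS hinv y r)))
    simp [Finset.sum_add_distrib] at heq
    simp only [Matrix.mulVec, dotProduct, hS, sub_mul, Finset.sum_mul]
    have hcomm : ∑ k, stackelIntegral S v k x * (deriv (σ r k) (x.1 r) * d.1 r) =
        ∑ k, deriv (σ r k) (x.1 r) * stackelIntegral S v k x * d.1 r :=
      Finset.sum_congr rfl fun k _ => by ring
    linarith
  have hsolve := congrArg (fun w => (S x.1)⁻¹.mulVec w) key
  simp only [Matrix.mulVec_mulVec, Matrix.nonsing_inv_mul _ (hinv x.1), Matrix.one_mulVec]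
    at hsolve
  exact congrFun hsolve j

end Stackel

/-- Along any orbit of the Stäckel Hamiltonian
`H = ∑ r (S⁻¹)_{1,r} H_r`, with `H_r(q,p) = ½(p_r² + v_r(q_r))`, each function
`t ↦ K_j(t) = ∑ r (S⁻¹(q(t)))_{j,r} H_r(q(t),p(t))` is constant on the
interval `I`; in particular `H` itself is constant along the curve. -/
theorem stmt_6 (N : ℕ) [NeZero N]
    (S : (Fin N → ℝ) → Matrix (Fin N) (Fin N) ℝ)
    (σ : Fin N → Fin N → ℝ → ℝ)
    (hσ : ∀ r j, Differentiable ℝ (σ r j))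
    (hS : ∀ q r j, S q r j = σ r j (q r))
    (hinv : ∀ q, IsUnit (S q).det)
    (v : Fin N → ℝ → ℝ) (hv : ∀ r, Differentiable ℝ (v r))
    (H : (Fin N → ℝ) × (Fin N → ℝ) → ℝ)
    (hH : ∀ x, H x = ∑ r : Fin N, (S x.1)⁻¹ 0 r * ((1 / 2) * ((x.2 r) ^ 2 + v r (x.1 r))))
    (I : Set ℝ) (hI : I.OrdConnected)
    (q p : ℝ → Fin N → ℝ)
    (hq : ∀ t ∈ I, ∀ i, DifferentiableAt ℝ (fun s => q s i) t)
    (hp : ∀ t ∈ I, ∀ i, DifferentiableAt ℝ (fun s => p s i) t)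
    (hHam : ∀ t ∈ I, ∀ i : Fin N,
      deriv (fun s => q s i) t = fderiv ℝ H (q t, p t) (0, Pi.single i 1) ∧
      deriv (fun s => p s i) t = -fderiv ℝ H (q t, p t) (Pi.single i 1, 0)) :
    (∀ j : Fin N, ∀ t₁ ∈ I, ∀ t₂ ∈ I,
      ∑ r : Fin N, (S (q t₁))⁻¹ j r * ((1 / 2) * ((p t₁ r) ^ 2 + v r (q t₁ r)))
        = ∑ r : Fin N, (S (q t₂))⁻¹ j r * ((1 / 2) * ((p t₂ r) ^ 2 + v r (q t₂ r)))) ∧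
    (∀ t₁ ∈ I, ∀ t₂ ∈ I, H (q t₁, p t₁) = H (q t₂, p t₂)) := by
  obtain rfl : H = stackelIntegral S v 0 := funext hH
  have hconst (j : Fin N) : ∀ t₁ ∈ I, ∀ t₂ ∈ I,
      stackelIntegral S v j (q t₁, p t₁) = stackelIntegral S v j (q t₂, p t₂) := by
    have hderiv : ∀ t ∈ I,
        HasDerivWithinAt (fun s => stackelIntegral S v j (q s, p s)) 0 I t := by
      intro t ht
      have hq' : HasDerivAt q (fun i => deriv (fun s => q s i) t) t :=
        hasDerivAt_pi.2 fun i => (hq t ht i).hasDerivAt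
      have hp' : HasDerivAt p (fun i => deriv (fun s => p s i) t) t :=
        hasDerivAt_pi.2 fun i => (hp t ht i).hasDerivAt
      have hchain := (differentiable_stackelIntegral hσ hS hinv hv j
        (q t, p t)).hasFDerivAt.comp_hasDerivAt t (hq'.prodMk hp')
      refine (hchain.congr_deriv ?_).hasDerivWithinAt
      rw [fderiv_stackelIntegral_apply hσ hS hinv hv]
      refine Finset.sum_eq_zero fun r _ => ?_
      simp only [(hHam t ht r).1, (hHam t ht r).2, fderiv_stackelIntegral_apply hσ hS hinv hv,
        Pi.single_apply, Pi.zero_apply, mul_zero, mul_ite, mul_one, zero_add, add_zero,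
        Finset.sum_ite_eq', Finset.mem_univ, if_true]
      ring
    intro t₁ h₁ t₂ h₂
    have hle := hI.convex.norm_image_sub_le_of_norm_hasDerivWithin_le (C := 0) hderiv
      (by simp) h₂ h₁
    rw [zero_mul] at hle
    exact sub_eq_zero.1 (norm_le_zero_iff.1 hle)
  exact ⟨hconst, hconst 0⟩
end

section
/- Fix a block assignment β : Fin N → Fin n and let S be a block-Stäckel matrix with twice differentiable entries; set α^m = (S^{-1})_{1,m} for m ∈ Fin n. Then the block-Levi-Civita equations hold: for every m ∈ Fin n and all i, j ∈ Fin N lying in different blocks (β(i) = r, β(j) = s, r ≠ s), α^r(q) α^s(q) ∂_i∂_j α^m(q) − α^r(q) (∂_i α^s(q)) (∂_j α^m(q)) − α^s(q) (∂_j α^r(q)) (∂_i α^m(q)) = 0 for all q ∈ ℝ^N. -/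
open scoped BigOperators

section InverseMatrix

variable {E : Type*} [NormedAddCommGroup E] [NormedSpace ℝ E] {n : ℕ}

lemma differentiable_matrix_det_s10 {M : E → Matrix (Fin n) (Fin n) ℝ}
    (hM : ∀ r j, Differentiable ℝ (fun q => M q r j)) :
    Differentiable ℝ (fun q => (M q).det) := by
  simp only [Matrix.det_apply]
  refine Differentiable.fun_sum fun σ _ => Differentiable.const_smul ?_ _
  exact fun q =>
    (HasFDerivAt.finsetProd fun i _ => (hM (σ i) i q).hasFDerivAt).differentiableAt

lemma differentiable_matrix_inv_apply_s10 {M : E → Matrix (Fin n) (Fin n) ℝ}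
    (hM : ∀ r j, Differentiable ℝ (fun q => M q r j)) (hinv : ∀ q, IsUnit (M q).det)
    (l m : Fin n) : Differentiable ℝ (fun q => (M q)⁻¹ l m) := by
  simp only [Matrix.inv_def, Matrix.smul_apply, smul_eq_mul, Ring.inverse_eq_inv',
    Matrix.adjugate_apply]
  refine ((differentiable_matrix_det_s10 hM).inv fun q => (hinv q).ne_zero).mul
    (differentiable_matrix_det_s10 fun r j => ?_)
  by_cases h : r = m
  · subst h
    simp
  · simpa [Matrix.updateRow_ne h] using hM r j

/-- The derivative of the inverse of a matrix-valued map, entry by entry. -/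
lemma fderiv_matrix_inv_apply {M : E → Matrix (Fin n) (Fin n) ℝ}
    (hM : ∀ r j, Differentiable ℝ (fun q => M q r j)) (hinv : ∀ q, IsUnit (M q).det)
    (l m : Fin n) (q v : E) :
    fderiv ℝ (fun q => (M q)⁻¹ l m) q v =
      -∑ k, (M q)⁻¹ l k * ∑ j, fderiv ℝ (fun q => M q k j) q v * (M q)⁻¹ j m := by
  have hA := differentiable_matrix_inv_apply_s10 hM hinv
  let dA : Matrix (Fin n) (Fin n) ℝ := .of fun k j => fderiv ℝ (fun q => (M q)⁻¹ k j) q v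
  let dM : Matrix (Fin n) (Fin n) ℝ := .of fun k j => fderiv ℝ (fun q => M q k j) q v
  have key : dA * M q + (M q)⁻¹ * dM = 0 := by
    ext a b
    have hconst : (fun q => ∑ k, (M q)⁻¹ a k * M q k b) = fun _ => (1 : Matrix _ _ ℝ) a b := by
      funext p
      rw [← Matrix.mul_apply, Matrix.nonsing_inv_mul _ (hinv p)]
    have hd := congrArg (fun f => fderiv ℝ f q v) hconst
    simp only [fderiv_fun_const, Pi.zero_apply] at hd
    rw [fderiv_fun_sum fun k _ => ((hA a k).fun_mul (hM k b)) q] at hd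
    simp only [fderiv_fun_mul (hA a _ q) (hM _ b q)] at hd
    simp only [sum_apply, add_apply,
      smul_apply, smul_eq_mul, zero_apply] at hd
    simp only [Matrix.add_apply, Matrix.mul_apply, Matrix.of_apply, dA, dM, Matrix.zero_apply,
      ← Finset.sum_add_distrib]
    rw [← hd]
    exact Finset.sum_congr rfl fun k _ => by ring
  have hdA : dA = -((M q)⁻¹ * (dM * (M q)⁻¹)) := by
    calc dA = dA * M q * (M q)⁻¹ := by rw [mul_assoc, Matrix.mul_nonsing_inv _ (hinv q), mul_one]
      _ = _ := by rw [eq_neg_of_add_eq_zero_left key, neg_mul, mul_assoc]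
  simpa [Matrix.mul_apply, dA, dM] using congrFun (congrFun hdA l) m

/-- If only row `r` of `M` varies in the direction `v`, the derivative of the inverse in that
direction has rank one. -/
lemma fderiv_matrix_inv_apply_of_row {M : E → Matrix (Fin n) (Fin n) ℝ}
    (hM : ∀ r j, Differentiable ℝ (fun q => M q r j)) (hinv : ∀ q, IsUnit (M q).det)
    {r : Fin n} {q v : E} (hrow : ∀ k j, r ≠ k → fderiv ℝ (fun q => M q k j) q v = 0)
    (l m : Fin n) :
    fderiv ℝ (fun q => (M q)⁻¹ l m) q v =
      -((M q)⁻¹ l r * ∑ j, fderiv ℝ (fun q => M q r j) q v * (M q)⁻¹ j m) := by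
  rw [fderiv_matrix_inv_apply hM hinv, Finset.sum_eq_single r]
  · intro k _ hk
    simp [hrow k _ hk.symm]
  · simp

/-- A mixed directional derivative of a `C²` function vanishes if the first-order derivative in the
outer direction vanishes identically. -/
lemma fderiv_fderiv_apply_eq_zero {f : E → ℝ} (hf : ContDiff ℝ 2 f) {v w : E}
    (hw : ∀ q, fderiv ℝ f q w = 0) (q : E) :
    fderiv ℝ (fun q' => fderiv ℝ f q' v) q w = 0 := by
  have hd : DifferentiableAt ℝ (fderiv ℝ f) q :=
    (hf.fderiv_right (m := 1) (by norm_num)).differentiable (by norm_num) q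
  have happ (u x : E) : fderiv ℝ (fun q' => fderiv ℝ f q' u) q x =
      fderiv ℝ (fderiv ℝ f) q x u := by
    rw [fderiv_clm_apply hd (differentiableAt_const u)]
    simp
  have hsymm : IsSymmSndFDerivAt ℝ f q := hf.contDiffAt.isSymmSndFDerivAt (by simp)
  rw [happ, hsymm.eq, ← happ]
  simp [hw]

end InverseMatrix

/-- The block-Levi-Civita equations: if `S` is a
block-Stäckel matrix with twice differentiable entries and `α^m = (S⁻¹)_{1,m}`,
then for all `m` and all coordinates `i`, `j` lying in different blocks,
`α^{β(i)} α^{β(j)} ∂_i∂_j α^m − α^{β(i)} (∂_i α^{β(j)})(∂_j α^m)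
  − α^{β(j)} (∂_j α^{β(i)})(∂_i α^m) = 0`. -/
theorem stmt_10 (N n : ℕ) [NeZero n] (β : Fin N → Fin n) (hβ : Function.Surjective β)
    (S : (Fin N → ℝ) → Matrix (Fin n) (Fin n) ℝ)
    (hSdiff : ∀ r j : Fin n, ContDiff ℝ 2 (fun q => S q r j))
    (hSinv : ∀ q, IsUnit (S q).det)
    (hSblock : ∀ (r j : Fin n) (i : Fin N), β i ≠ r →
      ∀ q : Fin N → ℝ, fderiv ℝ (fun q' => S q' r j) q (Pi.single i 1) = 0)
    (α : Fin n → (Fin N → ℝ) → ℝ)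
    (hα : ∀ m q, α m q = (S q)⁻¹ 0 m) :
    ∀ (m : Fin n) (i j : Fin N), β i ≠ β j → ∀ q : Fin N → ℝ,
      α (β i) q * α (β j) q
          * fderiv ℝ (fun q' => fderiv ℝ (α m) q' (Pi.single j 1)) q (Pi.single i 1)
        - α (β i) q * fderiv ℝ (α (β j)) q (Pi.single i 1)
            * fderiv ℝ (α m) q (Pi.single j 1)
        - α (β j) q * fderiv ℝ (α (β i)) q (Pi.single j 1)
            * fderiv ℝ (α m) q (Pi.single i 1) = 0 := by
  intro m i j hij q
  have hS (r k : Fin n) : Differentiable ℝ (fun q => S q r k) :=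
    (hSdiff r k).differentiable (by norm_num)
  have hA := differentiable_matrix_inv_apply_s10 hS hSinv
  obtain rfl : α = fun m q => (S q)⁻¹ 0 m := by
    funext m q
    exact hα m q
  let F (i : Fin N) (m : Fin n) (q : Fin N → ℝ) : ℝ :=
    ∑ k, fderiv ℝ (fun q' => S q' (β i) k) q (Pi.single i 1) * (S q)⁻¹ k m
  have hdA (i : Fin N) (l m : Fin n) (q : Fin N → ℝ) :
      fderiv ℝ (fun q' => (S q')⁻¹ l m) q (Pi.single i 1) = -((S q)⁻¹ l (β i) * F i m q) :=
    fderiv_matrix_inv_apply_of_row hS hSinv (fun k c hk => hSblock k c i hk q) l m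
  have hdS (k : Fin n) : Differentiable ℝ
      (fun q => fderiv ℝ (fun q' => S q' (β j) k) q (Pi.single j 1)) :=
    (((hSdiff (β j) k).fderiv_right (m := 1) (by norm_num)).differentiable
      (by norm_num)).clm_apply (differentiable_const _)
  have hF : Differentiable ℝ (F j m) :=
    Differentiable.fun_sum fun k _ => (hdS k).mul (hA k m)
  have hdF : fderiv ℝ (F j m) q (Pi.single i 1) = -(F j (β i) q * F i m q) := by
    simp only [F]
    rw [fderiv_fun_sum fun k _ => ((hdS k).fun_mul (hA k m)) q]
    simp only [fderiv_fun_mul (hdS _ q) (hA _ m q), sum_apply,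
      add_apply, smul_apply, smul_eq_mul,
      fderiv_fderiv_apply_eq_zero (hSdiff (β j) _) (hSblock (β j) _ i hij), hdA]
    rw [Finset.sum_mul, ← Finset.sum_neg_distrib]
    exact Finset.sum_congr rfl fun k _ => by simp only [F]; ring
  simp only [hdA]
  rw [fderiv_fun_neg, fderiv_fun_mul (hA 0 (β j) q) (hF q)]
  simp only [neg_apply, add_apply,
    smul_apply, smul_eq_mul, hdA, hdF]
  ring
end
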